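/- Let B be a commutative noetherian ring, 𝒜 an abelian category, and X a B-flat B-module object in 𝒜. Then for any finitely generated B-modules M and N there is an isomorphism ihom_B(N, M ⊗_B X) ≅ Hom_B(N, M) ⊗_B X in 𝒜. -/

import Mathlib

/-!
STATEMENT 11: Let `B` be a commutative noetherian ring, `𝒜` an abelian category, and `X` a
`B`-flat `B`-module object in `𝒜`.  Then for any finitely generated `B`-modules `M`, `N`
there is an isomorphism `ihom_B(N, M ⊗_B X) ≅ Hom_B(N, M) ⊗_B X`.

Tensor products `M ⊗_B X` and internal homs `ihom_B(N, Y)` are quantified via their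
characterizing universal properties.
-/

open CategoryTheory CategoryTheory.Limits

universe v u

namespace Paper

variable {B : Type} [CommRing B]
variable {𝒜 : Type u} [Category.{v} 𝒜] [Abelian 𝒜]

/-- A `B`-module object in `𝒜`. -/
structure BModObj (B : Type) [CommRing B] (𝒜 : Type u) [Category.{v} 𝒜] [Abelian 𝒜] where
  X : 𝒜
  ρ : B →+* End X

/-- The data classified by `Hom_𝒜(M ⊗_B X, Y)`, i.e. `B`-linear maps `M → Hom_𝒜(X,Y)`. -/
structure BPairing (M : Type) [AddCommGroup M] [Module B M] (Xo : BModObj B 𝒜) (Y : 𝒜) where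
  toFun : M → (Xo.X ⟶ Y)
  map_add : ∀ m m' : M, toFun (m + m') = toFun m + toFun m'
  map_smul : ∀ (b : B) (m : M), toFun (b • m) = (Xo.ρ b : Xo.X ⟶ Xo.X) ≫ toFun m

/-- A realization of `M ⊗_B X`, characterized by
`Hom_𝒜(M ⊗_B X, Y) ≅ Hom_B(M, Hom_𝒜(X, Y))` functorially in `Y`. -/
structure BTensor (M : Type) [AddCommGroup M] [Module B M] (Xo : BModObj B 𝒜) where
  T : 𝒜
  ρT : B →+* End T
  pair : BPairing M Xo T
  pair_ρ : ∀ (b : B) (m : M), pair.toFun m ≫ (ρT b : T ⟶ T) = pair.toFun (b • m)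
  univ : ∀ (Y : 𝒜) (p : BPairing M Xo Y),
    ∃! g : T ⟶ Y, ∀ m : M, pair.toFun m ≫ g = p.toFun m

/-- The data classified by `Hom_𝒜(Z, ihom_B(N, Y))`, i.e. `B`-linear maps
`N → Hom_𝒜(Z, Y)` where `Y` is a `B`-module object. -/
structure BCopairing (N : Type) [AddCommGroup N] [Module B N] (Yo : BModObj B 𝒜) (Z : 𝒜) where
  toFun : N → (Z ⟶ Yo.X)
  map_add : ∀ n n' : N, toFun (n + n') = toFun n + toFun n'
  map_smul : ∀ (b : B) (n : N), toFun (b • n) = toFun n ≫ (Yo.ρ b : Yo.X ⟶ Yo.X)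

/-- A realization of `ihom_B(N, Y)`, characterized by
`Hom_𝒜(Z, ihom_B(N,Y)) ≅ Hom_B(N, Hom_𝒜(Z, Y))` functorially in `Z`. -/
structure BIhom (N : Type) [AddCommGroup N] [Module B N] (Yo : BModObj B 𝒜) where
  H : 𝒜
  cop : BCopairing N Yo H
  univ : ∀ (Z : 𝒜) (q : BCopairing N Yo Z),
    ∃! g : Z ⟶ H, ∀ n : N, g ≫ cop.toFun n = q.toFun n

/-- `X` is `B`-flat: `(-) ⊗_B X` is exact on finitely generated `B`-modules. -/
def BFlat (Xo : BModObj B 𝒜) : Prop :=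
  ∀ (M' M M'' : Type) (_ : AddCommGroup M') (_ : AddCommGroup M) (_ : AddCommGroup M''),
  ∀ (_ : Module B M') (_ : Module B M) (_ : Module B M''),
  Module.Finite B M' → Module.Finite B M → Module.Finite B M'' →
  ∀ (α : M' →ₗ[B] M) (β : M →ₗ[B] M''),
    Function.Injective α → Function.Surjective β → Function.Exact α β →
  ∀ (T' : BTensor M' Xo) (T : BTensor M Xo) (T'' : BTensor M'' Xo)
    (g' : T'.T ⟶ T.T) (g : T.T ⟶ T''.T),
    (∀ m', T'.pair.toFun m' ≫ g' = T.pair.toFun (α m')) →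
    (∀ m, T.pair.toFun m ≫ g = T''.pair.toFun (β m)) →
    Mono g' ∧ Epi g ∧ ∀ w : g' ≫ g = 0, (ShortComplex.mk g' g w).Exact

def BPairing.hom {M : Type} [AddCommGroup M] [Module B M] {Xo : BModObj B 𝒜} {Y : 𝒜}
    (p : BPairing M Xo Y) : M →+ (Xo.X ⟶ Y) := AddMonoidHom.mk' p.toFun p.map_add

def BCopairing.hom {M : Type} [AddCommGroup M] [Module B M] {Xo : BModObj B 𝒜} {Y : 𝒜}
    (p : BCopairing M Xo Y) : M →+ (Y ⟶ Xo.X) := AddMonoidHom.mk' p.toFun p.map_add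

def BPairing.pre {M M' : Type} [AddCommGroup M] [Module B M] [AddCommGroup M'] [Module B M']
    {Xo : BModObj B 𝒜} {Y : 𝒜}
    (p : BPairing M Xo Y) (f : M' →ₗ[B] M) : BPairing M' Xo Y where
  toFun m := p.toFun (f m)
  map_add m m' := by rw [_root_.map_add, p.map_add]
  map_smul b m := by rw [_root_.map_smul, p.map_smul]

def BPairing.post {M : Type} [AddCommGroup M] [Module B M]
    {Xo : BModObj B 𝒜} {Y Y' : 𝒜}
    (p : BPairing M Xo Y) (f : Y ⟶ Y') : BPairing M Xo Y' where
  toFun m := p.toFun m ≫ f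
  map_add m m' := by rw [p.map_add, Preadditive.add_comp]
  map_smul b m := by rw [p.map_smul, Category.assoc]

theorem BTensor.hom_ext {M : Type} [AddCommGroup M] [Module B M] {Xo : BModObj B 𝒜}
    (T : BTensor M Xo) {Y : 𝒜} {f g : T.T ⟶ Y}
    (h : ∀ m, T.pair.toFun m ≫ f = T.pair.toFun m ≫ g) : f = g :=
  (T.univ Y (T.pair.post g)).unique h (fun _ => rfl)

theorem BTensor.exists_map {M M' : Type} [AddCommGroup M] [Module B M]
    [AddCommGroup M'] [Module B M'] {Xo : BModObj B 𝒜}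
    (T : BTensor M Xo) (T' : BTensor M' Xo) (f : M →ₗ[B] M') :
    ∃ g : T.T ⟶ T'.T, ∀ m, T.pair.toFun m ≫ g = T'.pair.toFun (f m) :=
  (T.univ _ (T'.pair.pre f)).exists

/-- The `B`-action on a tensor product is automatic. -/
theorem exists_tensor {M : Type} [AddCommGroup M] [Module B M] {Xo : BModObj B 𝒜}
    (T : 𝒜) (pair : BPairing M Xo T)
    (univ : ∀ (Y : 𝒜) (p : BPairing M Xo Y),
      ∃! g : T ⟶ Y, ∀ m : M, pair.toFun m ≫ g = p.toFun m) :
    ∃ T' : BTensor M Xo, ∃ h : T'.T = T, ∀ m, T'.pair.toFun m ≫ eqToHom h = pair.toFun m := by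
  have ext : ∀ {f g : T ⟶ T}, (∀ m, pair.toFun m ≫ f = pair.toFun m ≫ g) → f = g :=
    fun {f g} h => (univ T (pair.post g)).unique h (fun _ => rfl)
  choose r hr _ using fun b : B => univ T (pair.pre (LinearMap.lsmul B M b))
  have hr' : ∀ b m, pair.toFun m ≫ r b = pair.toFun (b • m) := hr
  refine ⟨⟨T, ⟨⟨⟨r, ?_⟩, ?_⟩, ?_, ?_⟩, pair, hr, univ⟩, rfl, by simp⟩
  · refine ext fun m => ?_
    rw [hr', one_smul, End.one_def, Category.comp_id]
  · intro a b
    refine ext fun m => ?_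
    rw [hr', End.mul_def, ← Category.assoc, hr', hr', mul_smul]
  · refine ext fun m => ?_
    change pair.toFun m ≫ r 0 = pair.hom m ≫ (0 : T ⟶ T)
    rw [hr', zero_smul, comp_zero]
    exact pair.hom.map_zero
  · intro a b
    refine ext fun m => ?_
    change pair.toFun m ≫ r (a + b) = pair.toFun m ≫ (r a + r b)
    rw [hr', Preadditive.comp_add, hr', hr', add_smul, pair.map_add]

theorem exists_tensor_self (Xo : BModObj B 𝒜) : Nonempty (BTensor B Xo) := by
  refine ⟨(exists_tensor Xo.X ⟨fun b => (Xo.ρ b : Xo.X ⟶ Xo.X), ?_, ?_⟩ ?_).choose⟩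
  · intro a b
    rw [map_add]
  · intro a b
    rw [smul_eq_mul, mul_comm, map_mul, End.mul_def]
  · intro Y p
    refine ⟨p.toFun 1, ?_, ?_⟩
    · intro b
      rw [← p.map_smul, smul_eq_mul, mul_one]
    · intro g hg
      have := hg 1
      simpa [End.one_def] using this

theorem exists_tensor_pi {M : Type} [AddCommGroup M] [Module B M] {Xo : BModObj B 𝒜}
    (T : BTensor M Xo) (a : ℕ) :
    ∃ (P : BTensor (Fin a → M) Xo) (π : Fin a → (P.T ⟶ T.T)),
      (∀ m i, P.pair.toFun m ≫ π i = T.pair.toFun (m i)) ∧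
      (∀ (Z : 𝒜) (f : Fin a → (Z ⟶ T.T)), ∃ g : Z ⟶ P.T, ∀ i, g ≫ π i = f i) ∧
      (∀ (Z : 𝒜) (f g : Z ⟶ P.T), (∀ i, f ≫ π i = g ≫ π i) → f = g) := by
  have := Abelian.hasFiniteBiproducts (C := 𝒜)
  obtain ⟨P, h, hP⟩ := exists_tensor (M := Fin a → M) (Xo := Xo) (⨁ fun _ : Fin a => T.T)
    ⟨fun m => biproduct.lift fun i => T.pair.toFun (m i), by
      intro m m'
      ext i
      simp [T.pair.map_add], by
      intro b m
      ext i
      simp [T.pair.map_smul]⟩ (by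
      intro Y p
      choose d hd _ using fun i => T.univ Y (p.pre (LinearMap.single B (fun _ : Fin a => M) i))
      have hd' : ∀ i m, T.pair.toFun m ≫ d i = p.toFun (Pi.single i m) := hd
      refine ⟨biproduct.desc d, ?_, ?_⟩
      · intro m
        simp only [biproduct.lift_desc, hd']
        change ∑ i, p.hom (Pi.single i (m i)) = p.hom m
        rw [← map_sum, Finset.univ_sum_single]
      · intro g hg
        refine biproduct.hom_ext' _ _ fun i => T.hom_ext fun m => ?_
        rw [biproduct.ι_desc, hd', ← hg, ← Category.assoc]
        congr 1
        refine biproduct.hom_ext _ _ fun j => ?_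
        rw [Category.assoc, biproduct.lift_π, biproduct.ι_π]
        by_cases hij : i = j
        · subst hij
          simp
        · have : T.pair.hom 0 = 0 := map_zero _
          have h2 : T.pair.toFun 0 = 0 := this
          simp [hij, Pi.single_eq_of_ne (Ne.symm hij), h2])
  refine ⟨P, fun i => eqToHom h ≫ biproduct.π _ i, ?_, ?_, ?_⟩
  · intro m i
    rw [← Category.assoc, hP]
    simp
  · intro Z f
    exact ⟨biproduct.lift f ≫ eqToHom h.symm, by simp⟩
  · intro Z f g hfg
    rw [← cancel_mono (eqToHom h)]
    refine biproduct.hom_ext _ _ fun i => ?_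
    simpa using hfg i

theorem exists_tensor_quot {M M' : Type} [AddCommGroup M] [Module B M] [AddCommGroup M']
    [Module B M'] {Xo : BModObj B 𝒜}
    (T : BTensor M Xo) (β : M →ₗ[B] M') (hβ : Function.Surjective β)
    (hk : (LinearMap.ker β).FG) : Nonempty (BTensor M' Xo) := by
  obtain ⟨b, k, hk⟩ := Submodule.fg_iff_exists_fin_generating_family.mp hk
  have := Abelian.hasFiniteBiproducts (C := 𝒜)
  let φ : (⨁ fun _ : Fin b => Xo.X) ⟶ T.T := biproduct.desc fun j => T.pair.toFun (k j)
  let π := cokernel.π φ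
  have h0 : ∀ m ∈ LinearMap.ker β, T.pair.toFun m ≫ π = 0 := by
    intro m hm
    rw [← hk] at hm
    induction hm using Submodule.span_induction with
    | mem x hx =>
      obtain ⟨j, rfl⟩ := hx
      have : T.pair.toFun (k j) = biproduct.ι (fun _ : Fin b => Xo.X) j ≫ φ := by simp [φ]
      rw [this, Category.assoc, cokernel.condition, comp_zero]
    | zero =>
      have : T.pair.hom 0 = 0 := map_zero _
      have h2 : T.pair.toFun 0 = 0 := this
      rw [h2, zero_comp]
    | add x y _ _ hx hy => rw [T.pair.map_add, Preadditive.add_comp, hx, hy, add_zero]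
    | smul c x _ hx => rw [T.pair.map_smul, Category.assoc, hx, comp_zero]
  have h1 : ∀ m m', β m = β m' → T.pair.toFun m ≫ π = T.pair.toFun m' ≫ π := by
    intro m m' h
    have h3 := h0 (m - m') (by simp [h])
    have h4 : T.pair.toFun (m - m') = T.pair.toFun m - T.pair.toFun m' := T.pair.hom.map_sub m m'
    rw [h4, Preadditive.sub_comp, sub_eq_zero] at h3
    exact h3
  obtain ⟨s, hs⟩ := hβ.hasRightInverse
  refine ⟨(exists_tensor (M := M') (Xo := Xo) (cokernel φ)
    ⟨fun m => T.pair.toFun (s m) ≫ π, ?_, ?_⟩ ?_).choose⟩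
  · intro m m'
    rw [← Preadditive.add_comp, ← T.pair.map_add]
    exact h1 _ _ (by rw [map_add, hs, hs, hs])
  · intro c m
    rw [← Category.assoc, ← T.pair.map_smul]
    exact h1 _ _ (by rw [map_smul, hs, hs])
  · intro Y p
    obtain ⟨g, hg, -⟩ := T.univ Y (p.pre β)
    have hg' : ∀ m, T.pair.toFun m ≫ g = p.toFun (β m) := hg
    have hg0 : φ ≫ g = 0 := by
      refine biproduct.hom_ext' _ _ fun j => ?_
      have h5 : β (k j) = 0 := by
        have : k j ∈ LinearMap.ker β := hk ▸ Submodule.subset_span ⟨j, rfl⟩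
        exact this
      have h6 : p.hom 0 = 0 := map_zero _
      have h2 : p.toFun 0 = 0 := h6
      simp only [φ, biproduct.ι_desc_assoc, comp_zero]
      rw [hg', h5, h2]
    refine ⟨cokernel.desc φ g hg0, ?_, ?_⟩
    · intro m
      simp only [π, Category.assoc, cokernel.π_desc]
      rw [hg', hs]
    · intro g' hg''
      rw [← cancel_epi (cokernel.π φ), cokernel.π_desc]
      refine T.hom_ext fun m => ?_
      rw [hg', ← hg'', ← Category.assoc]
      congr 1
      exact h1 _ _ (hs _).symm

theorem exists_tensor_fg [IsNoetherianRing B] (Xo : BModObj B 𝒜)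
    (M : Type) [AddCommGroup M] [Module B M] [Module.Finite B M] : Nonempty (BTensor M Xo) := by
  obtain ⟨a, f, hf⟩ := Module.Finite.exists_fin' B M
  obtain ⟨T⟩ := exists_tensor_self Xo
  obtain ⟨P, -⟩ := exists_tensor_pi T a
  exact exists_tensor_quot P f hf (IsNoetherian.noetherian _)

/-- Left exactness for flat objects. -/
theorem flat_left_exact [IsNoetherianRing B] (Xo : BModObj B 𝒜) (hX : BFlat Xo)
    {L M M' : Type} [AddCommGroup L] [Module B L] [AddCommGroup M] [Module B M]
    [AddCommGroup M'] [Module B M'] [Module.Finite B L] [Module.Finite B M] [Module.Finite B M']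
    (α : L →ₗ[B] M) (β : M →ₗ[B] M') (hα : Function.Injective α) (hαβ : Function.Exact α β)
    (TL : BTensor L Xo) (TM : BTensor M Xo) (TM' : BTensor M' Xo)
    (f : TL.T ⟶ TM.T) (g : TM.T ⟶ TM'.T)
    (hf : ∀ m, TL.pair.toFun m ≫ f = TM.pair.toFun (α m))
    (hg : ∀ m, TM.pair.toFun m ≫ g = TM'.pair.toFun (β m)) :
    Mono f ∧ ∀ (Z : 𝒜) (h : Z ⟶ TM.T), h ≫ g = 0 → ∃ l : Z ⟶ TL.T, l ≫ f = h := by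
  obtain ⟨TI⟩ := exists_tensor_fg Xo (LinearMap.range β)
  obtain ⟨TQ⟩ := exists_tensor_fg Xo (M' ⧸ LinearMap.range β)
  obtain ⟨e, he⟩ := TM.exists_map TI β.rangeRestrict
  obtain ⟨i, hi⟩ := TI.exists_map TM' (LinearMap.range β).subtype
  obtain ⟨c, hc⟩ := TM'.exists_map TQ (LinearMap.range β).mkQ
  have hex : Function.Exact α β.rangeRestrict := by
    intro m
    rw [← hαβ m]
    exact ⟨fun h => congrArg Subtype.val h, fun h => Subtype.ext h⟩
  obtain ⟨m1, -, ex1⟩ := hX _ _ _ _ _ _ _ _ _ inferInstance inferInstance inferInstance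
    α β.rangeRestrict hα β.surjective_rangeRestrict hex TL TM TI f e hf he
  obtain ⟨m2, -, -⟩ := hX _ _ _ _ _ _ _ _ _ inferInstance inferInstance inferInstance
    (LinearMap.range β).subtype (LinearMap.range β).mkQ (Submodule.subtype_injective _)
    (Submodule.mkQ_surjective _) (LinearMap.exact_subtype_mkQ _) TI TM' TQ i c hi hc
  have hei : e ≫ i = g := TM.hom_ext fun m => by
    rw [← Category.assoc, he, hi, hg]; rfl
  have hw : f ≫ e = 0 := TL.hom_ext fun m => by
    have h6 : TI.pair.hom 0 = 0 := map_zero _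
    have h2 : TI.pair.toFun 0 = 0 := h6
    rw [← Category.assoc, hf, he, hex.apply_apply_eq_zero, h2, comp_zero]
  refine ⟨m1, fun Z h hh => ?_⟩
  have h7 : h ≫ e = 0 := by
    rw [← cancel_mono i, Category.assoc, hei, hh, zero_comp]
  have E := ex1 hw
  have : Mono (ShortComplex.mk f e hw).f := m1
  exact ⟨E.lift h h7, E.lift_f h h7⟩

/-- For a commutative noetherian ring `B`, a `B`-flat module object `X` in
an abelian category `𝒜`, and finitely generated `B`-modules `M`, `N`, one has
`ihom_B(N, M ⊗_B X) ≅ Hom_B(N, M) ⊗_B X`. -/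
theorem statement_11
    [IsNoetherianRing B]
    (Xo : BModObj B 𝒜) (hX : BFlat Xo)
    (M N : Type) [AddCommGroup M] [Module B M] [AddCommGroup N] [Module B N]
    [Module.Finite B M] [Module.Finite B N]
    (T1 : BTensor M Xo)
    (H : BIhom N ⟨T1.T, T1.ρT⟩)
    (T2 : BTensor (N →ₗ[B] M) Xo) :
    Nonempty (H.H ≅ T2.T) := by
  obtain ⟨a, F, hF⟩ := Module.Finite.exists_fin' B N
  obtain ⟨b, k, hk⟩ := Submodule.fg_iff_exists_fin_generating_family.mp
    (IsNoetherian.noetherian (LinearMap.ker F))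
  let e : Fin a → (Fin a → B) := fun i => Pi.single i 1
  have hsum : ∀ x : Fin a → B, ∑ i, x i • e i = x := fun x => (pi_eq_sum_univ' x).symm
  have hFs : ∀ x : Fin a → B, F x = ∑ i, x i • F (e i) := fun x => by
    conv_lhs => rw [← hsum x]
    simp only [map_sum, map_smul]
  have hkF : ∀ j, F (k j) = 0 := fun j => by
    have : k j ∈ LinearMap.ker F := hk ▸ Submodule.subset_span ⟨j, rfl⟩
    exact this
  -- the left exact sequence
  let α : (N →ₗ[B] M) →ₗ[B] (Fin a → M) :=
    LinearMap.pi fun i => LinearMap.applyₗ (F (e i))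
  let β : (Fin a → M) →ₗ[B] (Fin b → M) :=
    LinearMap.pi fun j => ∑ i, k j i • LinearMap.proj i
  have hα : ∀ φ i, α φ i = φ (F (e i)) := fun φ i => rfl
  have hβ : ∀ m j, β m j = ∑ i, k j i • m i := fun m j => by simp [β]
  have hαi : Function.Injective α := by
    intro φ ψ h
    ext n
    obtain ⟨x, rfl⟩ := hF n
    have h' : ∀ i, φ (F (e i)) = ψ (F (e i)) := fun i => congrFun h i
    rw [hFs x]
    simp only [map_sum, map_smul, h']
  have hex : Function.Exact α β := by
    intro m
    constructor
    · intro hm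
      let G : (Fin a → B) →ₗ[B] M := ∑ i, (LinearMap.proj i : (Fin a → B) →ₗ[B] B).smulRight (m i)
      have hG : ∀ x, G x = ∑ i, x i • m i := fun x => by simp [G]
      have hle : LinearMap.ker F ≤ LinearMap.ker G := by
        rw [← hk, Submodule.span_le]
        rintro _ ⟨j, rfl⟩
        change G (k j) = 0
        rw [hG, ← hβ, hm]; rfl
      refine ⟨((LinearMap.ker F).liftQ G hle).comp
        (F.quotKerEquivOfSurjective hF).symm.toLinearMap, ?_⟩
      ext i
      rw [hα]
      have h8 : (F.quotKerEquivOfSurjective hF).symm (F (e i)) = Submodule.Quotient.mk (e i) := by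
        rw [LinearEquiv.symm_apply_eq]; rfl
      change (LinearMap.ker F).liftQ G hle ((F.quotKerEquivOfSurjective hF).symm (F (e i))) = m i
      rw [h8]
      change G (e i) = m i
      rw [hG]
      simp [e, Pi.single_apply]
    · rintro ⟨φ, rfl⟩
      ext j
      rw [hβ]
      simp only [hα]
      have := congrArg φ (hFs (k j))
      rw [hkF, map_zero] at this
      simp only [map_sum, map_smul] at this
      exact this.symm
  obtain ⟨Pa, πa, ha1, ha2, ha3⟩ := exists_tensor_pi T1 a
  obtain ⟨Pb, πb, hb1, hb2, hb3⟩ := exists_tensor_pi T1 b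
  obtain ⟨f, hf⟩ := T2.exists_map Pa α
  obtain ⟨g, hg⟩ := Pa.exists_map Pb β
  have : Module.Finite B (N →ₗ[B] M) := Module.Finite.of_injective α hαi
  obtain ⟨hm, hlift⟩ := flat_left_exact Xo hX α β hαi hex T2 Pa Pb f g hf hg
  have hgπ : ∀ j, g ≫ πb j = ∑ i, πa i ≫ (T1.ρT (k j i) : T1.T ⟶ T1.T) := by
    intro j
    refine Pa.hom_ext fun m => ?_
    rw [← Category.assoc, hg, hb1, hβ, Preadditive.comp_sum]
    simp only [← Category.assoc, ha1, T1.pair_ρ]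
    exact map_sum T1.pair.hom _ _
  -- evaluation maps
  choose ev hev using fun n : N => T2.exists_map T1 (LinearMap.applyₗ n)
  have hev' : ∀ n φ, T2.pair.toFun φ ≫ ev n = T1.pair.toFun (φ n) := hev
  let evc : BCopairing N (⟨T1.T, T1.ρT⟩ : BModObj B 𝒜) T2.T := ⟨ev, by
    intro n n'
    refine T2.hom_ext fun φ => ?_
    rw [Preadditive.comp_add, hev', hev', hev', map_add, T1.pair.map_add], by
    intro c n
    refine T2.hom_ext fun φ => ?_
    rw [← Category.assoc, hev', hev', map_smul, T1.pair_ρ]⟩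
  have hfπ : ∀ i, f ≫ πa i = ev (F (e i)) := fun i => T2.hom_ext fun φ => by
    rw [← Category.assoc, hf, ha1, hev', hα]
  have hq : ∀ (Z : 𝒜) (q : BCopairing N (⟨T1.T, T1.ρT⟩ : BModObj B 𝒜) Z) (x : Fin a → B),
      q.toFun (F x) = ∑ i, q.toFun (F (e i)) ≫ (T1.ρT (x i) : T1.T ⟶ T1.T) := by
    intro Z q x
    rw [hFs x]
    change q.hom _ = _
    rw [map_sum]
    exact Finset.sum_congr rfl fun i _ => q.map_smul _ _
  have hext : ∀ (Z : 𝒜) (u w : Z ⟶ T2.T), (∀ n, u ≫ ev n = w ≫ ev n) → u = w := by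
    intro Z u w h
    rw [← cancel_mono f]
    refine ha3 _ _ _ fun i => ?_
    rw [Category.assoc, Category.assoc, hfπ, h]
  have hex2 : ∀ (Z : 𝒜) (q : BCopairing N (⟨T1.T, T1.ρT⟩ : BModObj B 𝒜) Z),
      ∃ u : Z ⟶ T2.T, ∀ n, u ≫ ev n = q.toFun n := by
    intro Z q
    obtain ⟨h, hh⟩ := ha2 Z fun i => q.toFun (F (e i))
    have h0 : h ≫ g = 0 := by
      refine hb3 _ _ _ fun j => ?_
      rw [Category.assoc, hgπ, Preadditive.comp_sum, zero_comp]
      simp only [← Category.assoc, hh]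
      rw [← hq Z q (k j), hkF]
      exact q.hom.map_zero
    obtain ⟨l, hl⟩ := hlift Z h h0
    refine ⟨l, fun n => ?_⟩
    obtain ⟨x, rfl⟩ := hF n
    have h9 := hq _ evc x
    change ev (F x) = ∑ i, ev (F (e i)) ≫ (T1.ρT (x i) : T1.T ⟶ T1.T) at h9
    rw [hq Z q x, h9, Preadditive.comp_sum]
    refine Finset.sum_congr rfl fun i _ => ?_
    rw [← hfπ, ← hh, ← hl]
    simp only [Category.assoc]
  obtain ⟨u, hu⟩ := hex2 _ H.cop
  obtain ⟨w, hw, -⟩ := H.univ _ evc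
  have hw' : ∀ n, w ≫ H.cop.toFun n = ev n := hw
  refine ⟨⟨u, w, ?_, ?_⟩⟩
  · refine (H.univ _ H.cop).unique (fun n => ?_) (fun n => Category.id_comp _)
    rw [Category.assoc, hw', hu]
  · refine hext _ _ _ fun n => ?_
    rw [Category.assoc, hu, hw', Category.id_comp]

end Paper
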